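/- arXiv:1402.4944 — 5 statements merged into one kernel-verified Lean document; each statement's English description precedes it below -/
import Mathlib

section
/- Let X = MD(G, S0, S1, T0, T1) be a strongly connected mixed Cayley digraph. Suppose there exist a proper subgroup H of G with ⟨S0⟩ ≤ H and |H| < δ(X), and two distinct elements t0, t0' ∈ T0 with ⟨S1⟩ ≤ t0·H·t0⁻¹, T1⁻¹·t0 ⊆ H, t0'·H ∩ t0·H = ∅, and t0⁻¹·(T0 \ {t0'}) ⊆ H. Then λ(X) < δ(X). -/
open Set Pointwise

/-- Arc relation of the mixed Cayley digraph `MD(G,S0,S1,T0,T1)` on vertex set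
`G × Bool`, where `false` plays the role of the index `0` and `true` of `1`. -/
def MDArc {G : Type*} [Group G] (S0 S1 T0 T1 : Set G) (u v : G × Bool) : Prop :=
  (u.2 = false ∧ v.2 = false ∧ ∃ s ∈ S0, v.1 = s * u.1) ∨
  (u.2 = true ∧ v.2 = true ∧ ∃ s ∈ S1, v.1 = s * u.1) ∨
  (u.2 = false ∧ v.2 = true ∧ ∃ t ∈ T0, v.1 = t * u.1) ∨
  (u.2 = true ∧ v.2 = false ∧ ∃ t ∈ T1, u.1 = t * v.1)

/-- A digraph (given by its arc relation) is strongly connected if every vertex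
is reachable from every other vertex by a directed path. -/
def DigraphStronglyConnected {V : Type*} (R : V → V → Prop) : Prop :=
  ∀ u v : V, Relation.ReflTransGen R u v

/-- Out-degree of a vertex: the number of arcs originating at it. -/
noncomputable def outDegree {V : Type*} (R : V → V → Prop) (v : V) : ℕ :=
  {w | R v w}.ncard

/-- In-degree of a vertex: the number of arcs terminating at it. -/
noncomputable def inDegree {V : Type*} (R : V → V → Prop) (v : V) : ℕ :=
  {w | R w v}.ncard

/-- `δ`: the minimum, over all vertices, of in-degrees and out-degrees. -/
noncomputable def minDegree {V : Type*} (R : V → V → Prop) : ℕ :=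
  sInf {n | ∃ v, n = outDegree R v ∨ n = inDegree R v}

/-- `W` is an arc-disconnecting set: a set of arcs whose deletion leaves a
digraph that is not strongly connected. -/
def IsDisconnectingArcSet {V : Type*} (R : V → V → Prop) (W : Set (V × V)) : Prop :=
  (∀ p ∈ W, R p.1 p.2) ∧
  ¬ DigraphStronglyConnected (fun u v => R u v ∧ (u, v) ∉ W)

/-- The arc connectivity `λ`: the minimum cardinality of an arc-disconnecting set. -/
noncomputable def arcConnectivity {V : Type*} (R : V → V → Prop) : ℕ :=
  sInf {n | ∃ W : Set (V × V), IsDisconnectingArcSet R W ∧ W.ncard = n}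

/-- `ω⁺(A)`: the set of arcs from `A` to its complement. -/
def omegaPlus {V : Type*} (R : V → V → Prop) (A : Set V) : Set (V × V) :=
  {p | R p.1 p.2 ∧ p.1 ∈ A ∧ p.2 ∉ A}

/-- `ω⁻(A)`: the set of arcs from the complement of `A` to `A`. -/
def omegaMinus {V : Type*} (R : V → V → Prop) (A : Set V) : Set (V × V) :=
  {p | R p.1 p.2 ∧ p.1 ∉ A ∧ p.2 ∈ A}

/-- A positive arc fragment: a proper nonempty vertex subset with `|ω⁺(A)| = λ`. -/
def IsPosFragment {V : Type*} (R : V → V → Prop) (A : Set V) : Prop :=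
  A.Nonempty ∧ A ≠ Set.univ ∧ (omegaPlus R A).ncard = arcConnectivity R

/-- A negative arc fragment: a proper nonempty vertex subset with `|ω⁻(A)| = λ`. -/
def IsNegFragment {V : Type*} (R : V → V → Prop) (A : Set V) : Prop :=
  A.Nonempty ∧ A ≠ Set.univ ∧ (omegaMinus R A).ncard = arcConnectivity R

/-- An arc fragment: a positive or negative arc fragment. -/
def IsArcFragment {V : Type*} (R : V → V → Prop) (A : Set V) : Prop :=
  IsPosFragment R A ∨ IsNegFragment R A

/-- A `λ`-atom: an arc fragment of least possible cardinality. -/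
def IsLambdaAtom {V : Type*} (R : V → V → Prop) (A : Set V) : Prop :=
  IsArcFragment R A ∧ ∀ B, IsArcFragment R B → A.ncard ≤ B.ncard

/-- A positive `λ`-atom: a positive arc fragment of least possible cardinality
among all arc fragments. -/
def IsPosLambdaAtom {V : Type*} (R : V → V → Prop) (A : Set V) : Prop :=
  IsPosFragment R A ∧ ∀ B, IsArcFragment R B → A.ncard ≤ B.ncard

/-- A negative `λ`-atom: a negative arc fragment of least possible cardinality
among all arc fragments. -/
def IsNegLambdaAtom {V : Type*} (R : V → V → Prop) (A : Set V) : Prop :=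
  IsNegFragment R A ∧ ∀ B, IsArcFragment R B → A.ncard ≤ B.ncard

/-- A `λ`-superatom: an arc fragment with at least two vertices, of least
possible cardinality among arc fragments with at least two vertices. -/
def IsLambdaSuperatom {V : Type*} (R : V → V → Prop) (A : Set V) : Prop :=
  IsArcFragment R A ∧ 2 ≤ A.ncard ∧
    ∀ B, IsArcFragment R B → 2 ≤ B.ncard → A.ncard ≤ B.ncard

/-- A positive `λ`-superatom. -/
def IsPosLambdaSuperatom {V : Type*} (R : V → V → Prop) (A : Set V) : Prop :=
  IsPosFragment R A ∧ 2 ≤ A.ncard ∧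
    ∀ B, IsArcFragment R B → 2 ≤ B.ncard → A.ncard ≤ B.ncard

/-- A negative `λ`-superatom. -/
def IsNegLambdaSuperatom {V : Type*} (R : V → V → Prop) (A : Set V) : Prop :=
  IsNegFragment R A ∧ 2 ≤ A.ncard ∧
    ∀ B, IsArcFragment R B → 2 ≤ B.ncard → A.ncard ≤ B.ncard

/-- The set of out-arcs of a vertex. -/
def outArcsOf {V : Type*} (R : V → V → Prop) (v : V) : Set (V × V) :=
  {p | R p.1 p.2 ∧ p.1 = v}

/-- The set of in-arcs of a vertex. -/
def inArcsOf {V : Type*} (R : V → V → Prop) (v : V) : Set (V × V) :=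
  {p | R p.1 p.2 ∧ p.2 = v}

/-- A digraph is super-`λ` if every minimum arc-disconnecting set is the set of
in-arcs of some vertex or the set of out-arcs of some vertex. -/
def SuperLambda {V : Type*} (R : V → V → Prop) : Prop :=
  ∀ W : Set (V × V), IsDisconnectingArcSet R W → W.ncard = arcConnectivity R →
    (∃ v, W = outArcsOf R v) ∨ (∃ v, W = inArcsOf R v)

/-- The arcs leaving a proper nonempty vertex set form an arc-disconnecting set. -/
theorem isDisconnectingArcSet_omegaPlus {V : Type*} (R : V → V → Prop) {A : Set V} {a b : V}
    (ha : a ∈ A) (hb : b ∉ A) : IsDisconnectingArcSet R (omegaPlus R A) := by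
  refine ⟨fun p hp => hp.1, fun hsc => ?_⟩
  have closed : ∀ v, Relation.ReflTransGen (fun u v => R u v ∧ (u, v) ∉ omegaPlus R A) a v →
      v ∈ A := by
    intro v hv
    induction hv with
    | refl => exact ha
    | tail _ hstep ih => exact by_contra fun hc => hstep.2 ⟨hstep.1, ih, hc⟩
  exact hb (closed b (hsc a b))

/-- The arc-connectivity is at most the number of arcs leaving a proper nonempty vertex set. -/
theorem arcConnectivity_le_ncard_omegaPlus {V : Type*} (R : V → V → Prop) {A : Set V} {a b : V}
    (ha : a ∈ A) (hb : b ∉ A) : arcConnectivity R ≤ (omegaPlus R A).ncard :=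
  Nat.sInf_le ⟨_, isDisconnectingArcSet_omegaPlus R ha hb, rfl⟩

/-- The vertex set `H × {0} ∪ t₀H × {1}`. -/
def cosetPair {G : Type*} [Group G] (H : Subgroup G) (t0 : G) : Set (G × Bool) :=
  {v | (v.2 = false ∧ v.1 ∈ H) ∨ (v.2 = true ∧ t0⁻¹ * v.1 ∈ H)}

/-- Only arcs of the form `(h, 0) → (t₀'h, 1)` with `h ∈ H` leave `H × {0} ∪ t₀H × {1}`. -/
theorem omegaPlus_cosetPair_subset {G : Type*} [Group G] {S0 S1 T0 T1 : Set G} {H : Subgroup G}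
    {t0 t0' : G} (hS0 : ∀ s ∈ S0, s ∈ H) (hS1 : ∀ s ∈ S1, t0⁻¹ * s * t0 ∈ H)
    (hT0 : ∀ t ∈ T0, t ≠ t0' → t0⁻¹ * t ∈ H) (hT1 : ∀ t ∈ T1, t⁻¹ * t0 ∈ H) :
    omegaPlus (MDArc S0 S1 T0 T1) (cosetPair H t0) ⊆
      (fun h => ((h, false), (t0' * h, true))) '' (H : Set G) := by
  rintro ⟨⟨g, i⟩, ⟨k, j⟩⟩ ⟨harc, hin, hout⟩
  simp only [MDArc, cosetPair, mem_ofPred_eq] at harc hin hout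
  rcases harc with ⟨rfl, rfl, s, hs, rfl⟩ | ⟨rfl, rfl, s, hs, rfl⟩ | ⟨rfl, rfl, t, ht, rfl⟩ |
    ⟨rfl, rfl, t, ht, rfl⟩ <;> simp only [Bool.true_eq_false, Bool.false_eq_true, false_and,
      true_and, or_false, false_or] at hin hout
  · exact absurd (H.mul_mem (hS0 s hs) hin) hout
  · refine absurd ?_ hout
    simpa [mul_assoc] using H.mul_mem (hS1 s hs) hin
  · by_cases h : t = t0'
    · exact ⟨g, hin, by rw [h]⟩
    · refine absurd ?_ hout
      simpa [mul_assoc] using H.mul_mem (hT0 t ht h) hin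
  · refine absurd ?_ hout
    simpa [mul_assoc] using H.mul_mem (hT1 t ht) hin

/-- Condition 2 implies `λ(X) < δ(X)`. -/
theorem mixedCayley_condition2_not_maxLambda
    {G : Type*} [Group G] [Fintype G] (S0 S1 T0 T1 : Set G)
    (hS0 : (1 : G) ∉ S0) (hS1 : (1 : G) ∉ S1)
    (hT0 : T0.Nonempty) (hT1 : T1.Nonempty)
    (hsc : DigraphStronglyConnected (MDArc S0 S1 T0 T1))
    (H : Subgroup G) (hH : H ≠ ⊤)
    (hgen : Subgroup.closure S0 ≤ H)
    (hcard : Nat.card H < minDegree (MDArc S0 S1 T0 T1))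
    (t0 t0' : G) (ht0 : t0 ∈ T0) (ht0' : t0' ∈ T0) (hne : t0 ≠ t0')
    (hS1H : (Subgroup.closure S1 : Set G) ⊆ {t0} * (H : Set G) * {t0}⁻¹)
    (hT1H : T1⁻¹ * {t0} ⊆ (H : Set G))
    (hdisj : ({t0'} * (H : Set G)) ∩ ({t0} * (H : Set G)) = ∅)
    (hT0H : {t0}⁻¹ * (T0 \ {t0'}) ⊆ (H : Set G)) :
    arcConnectivity (MDArc S0 S1 T0 T1) < minDegree (MDArc S0 S1 T0 T1) := by
  obtain ⟨x, hx⟩ : ∃ x, x ∉ H := by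
    by_contra! h
    exact hH (H.eq_top_iff'.2 h)
  have hsub := omegaPlus_cosetPair_subset (S0 := S0) (S1 := S1) (T0 := T0) (T1 := T1) (H := H)
    (t0 := t0) (t0' := t0') (fun s hs => hgen (Subgroup.subset_closure hs))
    (fun s hs => by
      obtain ⟨_, ⟨_, rfl, h, hh, rfl⟩, y, hy, rfl⟩ := hS1H (Subgroup.subset_closure hs)
      rw [inv_singleton, mem_singleton_iff] at hy
      simpa [hy, mul_assoc] using hh)
    (fun t ht htne => hT0H (mul_mem_mul (by simp) ⟨ht, htne⟩))
    (fun t ht => hT1H (mul_mem_mul (inv_mem_inv.2 ht) rfl))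
  have hle : arcConnectivity (MDArc S0 S1 T0 T1) ≤ _ :=
    arcConnectivity_le_ncard_omegaPlus _ (A := cosetPair H t0) (a := (1, false)) (b := (x, false))
      (by simp [cosetPair, H.one_mem]) (by simpa [cosetPair] using hx)
  calc arcConnectivity (MDArc S0 S1 T0 T1)
      ≤ (omegaPlus (MDArc S0 S1 T0 T1) (cosetPair H t0)).ncard := hle
    _ ≤ _ := ncard_le_ncard hsub (toFinite _)
    _ ≤ (H : Set G).ncard := ncard_image_le (toFinite _)
    _ = Nat.card H := rfl
    _ < _ := hcard
end

section
/- Let X = MD(G, S0, S1, T0, T1) be a strongly connected mixed Cayley digraph. Suppose there exist a proper subgroup H of G with ⟨S1⟩ ≤ H and |H| < δ(X), and two distinct elements t1, t1' ∈ T1 with ⟨S0⟩ ≤ t1⁻¹·H·t1, T0·t1⁻¹ ⊆ H, t1'⁻¹·H ∩ t1⁻¹·H = ∅, and t1·(T1⁻¹ \ {t1'⁻¹}) ⊆ H. Then λ(X) < δ(X). -/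
open Set Pointwise

/-- If `A` is closed under the arcs outside `W`, contains `u` and omits `v`, then `W` disconnects. -/
theorem isDisconnectingArcSet_of_closed {V : Type*} {R : V → V → Prop} {W : Set (V × V)}
    (hW : ∀ p ∈ W, R p.1 p.2) (A : Set V) {u v : V} (hu : u ∈ A) (hv : v ∉ A)
    (hA : ∀ x ∈ A, ∀ y, R x y → (x, y) ∉ W → y ∈ A) : IsDisconnectingArcSet R W := by
  refine ⟨hW, fun hsc => hv ?_⟩
  clear hv
  induction hsc u v with
  | refl => exact hu
  | tail _ h ih => exact hA _ ih _ h.1 h.2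

/-- Condition 4 implies `λ(X) < δ(X)`. -/
theorem mixedCayley_condition4_not_maxLambda
    {G : Type*} [Group G] [Fintype G] (S0 S1 T0 T1 : Set G)
    (hS0 : (1 : G) ∉ S0) (hS1 : (1 : G) ∉ S1)
    (hT0 : T0.Nonempty) (hT1 : T1.Nonempty)
    (hsc : DigraphStronglyConnected (MDArc S0 S1 T0 T1))
    (H : Subgroup G) (hH : H ≠ ⊤)
    (hgen : Subgroup.closure S1 ≤ H)
    (hcard : Nat.card H < minDegree (MDArc S0 S1 T0 T1))
    (t1 t1' : G) (ht1 : t1 ∈ T1) (ht1' : t1' ∈ T1) (hne : t1 ≠ t1')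
    (hS0H : (Subgroup.closure S0 : Set G) ⊆ {t1}⁻¹ * (H : Set G) * {t1})
    (hT0H : T0 * {t1}⁻¹ ⊆ (H : Set G))
    (hdisj : ({t1'}⁻¹ * (H : Set G)) ∩ ({t1}⁻¹ * (H : Set G)) = ∅)
    (hT1H : {t1} * (T1⁻¹ \ {t1'}⁻¹) ⊆ (H : Set G)) :
    arcConnectivity (MDArc S0 S1 T0 T1) < minDegree (MDArc S0 S1 T0 T1) := by
  refine lt_of_le_of_lt ?_ hcard
  let f : G → (G × Bool) × (G × Bool) := fun h => ((h, true), (t1'⁻¹ * h, false))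
  have hW : IsDisconnectingArcSet (MDArc S0 S1 T0 T1) (f '' (H : Set G)) := by
    obtain ⟨x, hx⟩ : ∃ x, x ∉ H := by
      by_contra! h
      exact hH ((Subgroup.eq_top_iff' H).2 h)
    refine isDisconnectingArcSet_of_closed ?_
      {p | (p.2 = true ∧ p.1 ∈ H) ∨ (p.2 = false ∧ t1 * p.1 ∈ H)}
      (u := (1, true)) (v := (x, true)) (by simp [H.one_mem]) (by simpa using hx) ?_
    · rintro _ ⟨h, -, rfl⟩
      exact Or.inr (Or.inr (Or.inr ⟨rfl, rfl, t1', ht1', by simp [f]⟩))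
    · rintro ⟨a, i⟩ ha ⟨b, j⟩ hab hnot
      simp only [Set.mem_ofPred_eq] at ha ⊢
      rcases hab with ⟨hi, hj, s, hs, hb⟩ | ⟨hi, hj, s, hs, hb⟩ | ⟨hi, hj, t, ht, hb⟩ |
        ⟨hi, hj, t, ht, hb⟩ <;> dsimp only at hi hj hb <;> subst hi hj hb <;>
        simp only [Bool.false_eq_true, Bool.true_eq_false, false_and, true_and, false_or,
          or_false] at ha ⊢
      · obtain ⟨_, ⟨y, hy, h, hh, rfl⟩, z, hz, hs'⟩ := hS0H (Subgroup.subset_closure hs)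
        rw [Set.inv_singleton, Set.mem_singleton_iff] at hy
        rw [Set.mem_singleton_iff] at hz
        subst hy hz hs'
        simpa [mul_assoc] using H.mul_mem hh ha
      · exact H.mul_mem (hgen (Subgroup.subset_closure hs)) ha
      · have h := hT0H (Set.mul_mem_mul ht (by simp : t1⁻¹ ∈ ({t1}⁻¹ : Set G)))
        simpa [mul_assoc] using H.mul_mem h ha
      · by_cases htt : t = t1'
        · subst htt
          exact absurd ⟨_, ha, by simp [f]⟩ hnot
        · have h := hT1H (Set.mul_mem_mul (Set.mem_singleton t1)
            (⟨by simpa using ht, by simpa using htt⟩ : t⁻¹ ∈ T1⁻¹ \ {t1'}⁻¹))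
          simpa [mul_assoc] using H.mul_mem h ha
  calc arcConnectivity (MDArc S0 S1 T0 T1) ≤ (f '' (H : Set G)).ncard := Nat.sInf_le ⟨_, hW, rfl⟩
    _ ≤ (H : Set G).ncard := Set.ncard_image_le (Set.toFinite _)
    _ = Nat.card H := rfl
end

section
/- Let X = MD(G, S0, S1, T0, T1) be a strongly connected mixed Cayley digraph that is max-λ but not super-λ, and let A be a λ-superatom of X. If δ(X) = 1, then A ∩ X_i ≠ ∅ for i = 0 and i = 1, where X_i = G × {i}. -/
open Set Pointwise

/-- If every vertex of `A` has an out-neighbour outside `A`, then `ω⁺(A)` has at least `|A|` arcs. -/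
theorem ncard_le_ncard_omegaPlus {V : Type*} [Finite V] (R : V → V → Prop) (A : Set V) (f : V → V)
    (hR : ∀ v ∈ A, R v (f v)) (hf : ∀ v ∈ A, f v ∉ A) : A.ncard ≤ (omegaPlus R A).ncard :=
  Set.ncard_le_ncard_of_injOn (fun v => (v, f v)) (fun v hv => ⟨hR v hv, hv, hf v hv⟩)
    (fun _ _ _ _ h => congrArg Prod.fst h) (Set.toFinite _)

/-- If every vertex of `A` has an in-neighbour outside `A`, then `ω⁻(A)` has at least `|A|` arcs. -/
theorem ncard_le_ncard_omegaMinus {V : Type*} [Finite V] (R : V → V → Prop) (A : Set V) (f : V → V)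
    (hR : ∀ v ∈ A, R (f v) v) (hf : ∀ v ∈ A, f v ∉ A) : A.ncard ≤ (omegaMinus R A).ncard :=
  Set.ncard_le_ncard_of_injOn (fun v => (f v, v)) (fun v hv => ⟨hR v hv, hf v hv, hv⟩)
    (fun _ _ _ _ h => congrArg Prod.snd h) (Set.toFinite _)

/-- Every vertex has an out-neighbour on the other side. -/
theorem exists_MDArc_to_other_side {G : Type*} [Group G] (S0 S1 : Set G) {T0 T1 : Set G}
    (hT0 : T0.Nonempty) (hT1 : T1.Nonempty) (v : G × Bool) :
    ∃ w : G × Bool, w.2 = !v.2 ∧ MDArc S0 S1 T0 T1 v w := by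
  obtain ⟨t, ht⟩ := hT0
  obtain ⟨t', ht'⟩ := hT1
  obtain ⟨g, _ | _⟩ := v
  · exact ⟨(t * g, true), rfl, Or.inr (Or.inr (Or.inl ⟨rfl, rfl, t, ht, rfl⟩))⟩
  · exact ⟨(t'⁻¹ * g, false), rfl,
      Or.inr (Or.inr (Or.inr ⟨rfl, rfl, t', ht', (mul_inv_cancel_left t' g).symm⟩))⟩

/-- Every vertex has an in-neighbour on the other side. -/
theorem exists_MDArc_from_other_side {G : Type*} [Group G] (S0 S1 : Set G) {T0 T1 : Set G}
    (hT0 : T0.Nonempty) (hT1 : T1.Nonempty) (v : G × Bool) :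
    ∃ w : G × Bool, w.2 = !v.2 ∧ MDArc S0 S1 T0 T1 w v := by
  obtain ⟨t, ht⟩ := hT0
  obtain ⟨t', ht'⟩ := hT1
  obtain ⟨g, _ | _⟩ := v
  · exact ⟨(t' * g, true), rfl, Or.inr (Or.inr (Or.inr ⟨rfl, rfl, t', ht', rfl⟩))⟩
  · exact ⟨(t⁻¹ * g, false), rfl,
      Or.inr (Or.inr (Or.inl ⟨rfl, rfl, t, ht, (mul_inv_cancel_left t g).symm⟩))⟩

/-- if `X` is max-λ but not super-λ, `A` a λ-superatom and
`δ(X) = 1`, then `A` meets both `X_0` and `X_1`. -/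
theorem mixedCayley_superatom_meets_sides_of_minDegree_one
    {G : Type*} [Group G] [Fintype G] (S0 S1 T0 T1 : Set G)
    (hS0 : (1 : G) ∉ S0) (hS1 : (1 : G) ∉ S1)
    (hT0 : T0.Nonempty) (hT1 : T1.Nonempty)
    (hsc : DigraphStronglyConnected (MDArc S0 S1 T0 T1))
    (hmax : arcConnectivity (MDArc S0 S1 T0 T1) = minDegree (MDArc S0 S1 T0 T1))
    (hnsuper : ¬ SuperLambda (MDArc S0 S1 T0 T1))
    (A : Set (G × Bool)) (hA : IsLambdaSuperatom (MDArc S0 S1 T0 T1) A)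
    (hdelta : minDegree (MDArc S0 S1 T0 T1) = 1) :
    ∀ i : Bool, (A ∩ {p : G × Bool | p.2 = i}).Nonempty := by
  intro i
  by_contra hempty
  have hside : ∀ v ∈ A, v.2 = !i := fun v hv =>
    Bool.eq_not_of_ne fun hi => hempty ⟨v, hv, hi⟩
  have hout : ∀ v ∈ A, ∀ w : G × Bool, w.2 = !v.2 → w ∉ A := by
    intro v hv w hw hwA
    rw [hside v hv, hside w hwA] at hw
    simp at hw
  obtain ⟨hfrag, hcard, -⟩ := hA
  rcases hfrag with ⟨-, -, hlam⟩ | ⟨-, -, hlam⟩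
  · choose f hf hR using exists_MDArc_to_other_side S0 S1 hT0 hT1
    have := ncard_le_ncard_omegaPlus (MDArc S0 S1 T0 T1) A f (fun v _ => hR v)
      (fun v hv => hout v hv _ (hf v))
    omega
  · choose f hf hR using exists_MDArc_from_other_side S0 S1 hT0 hT1
    have := ncard_le_ncard_omegaMinus (MDArc S0 S1 T0 T1) A f (fun v _ => hR v)
      (fun v hv => hout v hv _ (hf v))
    omega
end

section
/- Let X = MD(G, S0, S1, T0, T1) be a strongly connected mixed Cayley digraph that is max-λ but not super-λ, and let A be a λ-superatom of X. Then |A| ≥ δ(X). -/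
open Set Pointwise

/-- In a loopless finite digraph all of whose out-degrees are at least `d`, a set of at least two
vertices that is left by at most `d` arcs has at least `d` elements. -/
theorem le_ncard_of_omegaPlus_ncard_le {V : Type*} [Finite V] {R : V → V → Prop}
    (hR : ∀ v, ¬ R v v) {d : ℕ} (hd : ∀ v, d ≤ outDegree R v) {A : Set V}
    (hA : 2 ≤ A.ncard) (hω : (omegaPlus R A).ncard ≤ d) : d ≤ A.ncard := by
  classical
  have := Fintype.ofFinite V
  have hsum : (omegaPlus R A).ncard = ∑ v ∈ A.toFinset, {w | R v w ∧ w ∉ A}.ncard := by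
    rw [ncard_eq_toFinset_card',
      Finset.card_eq_sum_card_fiberwise (f := Prod.fst) (t := A.toFinset)]
    · refine Finset.sum_congr rfl fun v hv => ?_
      rw [← ncard_coe_finset,
        ← ncard_image_of_injective {w | R v w ∧ w ∉ A} (Prod.mk_right_injective v)]
      refine congrArg Set.ncard (Set.ext fun ⟨x, y⟩ => ?_)
      rw [mem_toFinset] at hv
      simp only [Finset.coe_filter, omegaPlus, mem_ofPred_eq, mem_image,
        Prod.mk.injEq]
      grind
    · intro p hp
      have hp' : p ∈ omegaPlus R A := mem_toFinset.mp hp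
      exact mem_toFinset.mpr hp'.2.1
  have hdeg : ∀ v ∈ A.toFinset, d ≤ {w | R v w ∧ w ∉ A}.ncard + (A.ncard - 1) := by
    intro v hv
    rw [← ncard_sdiff_singleton_of_mem (mem_toFinset.mp hv)]
    refine (hd v).trans ((ncard_le_ncard ?_ (toFinite _)).trans (ncard_union_le _ _))
    intro w hw
    by_cases hwA : w ∈ A
    · exact Or.inr ⟨hwA, fun h => hR v (h ▸ hw)⟩
    · exact Or.inl ⟨hw, hwA⟩
  have hle := Finset.sum_le_sum hdeg
  rw [Finset.sum_add_distrib, ← hsum, Finset.sum_const, Finset.sum_const,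
    ← ncard_eq_toFinset_card', smul_eq_mul, smul_eq_mul] at hle
  obtain ⟨k, hk⟩ : ∃ k, A.ncard = k + 1 := ⟨A.ncard - 1, by omega⟩
  rw [hk, Nat.add_sub_cancel] at hle
  rw [hk]
  have hkpos : 0 < k := by omega
  refine Nat.le_of_mul_le_mul_left ?_ hkpos
  linarith

/-- Reversing all arcs turns `ω⁻` into `ω⁺`, up to swapping the ends of each arc. -/
theorem ncard_omegaPlus_flip {V : Type*} (R : V → V → Prop) (A : Set V) :
    (omegaPlus (flip R) A).ncard = (omegaMinus R A).ncard := by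
  rw [← ncard_image_of_injective _ Prod.swap_injective]
  congr 1
  ext ⟨x, y⟩
  simp only [omegaPlus, omegaMinus, flip, image_swap_eq_preimage_swap, mem_preimage,
    mem_ofPred_eq, Prod.fst_swap, Prod.snd_swap]
  tauto

theorem minDegree_le_outDegree {V : Type*} (R : V → V → Prop) (v : V) :
    minDegree R ≤ outDegree R v :=
  Nat.sInf_le (show _ ∈ {n | ∃ v, n = outDegree R v ∨ n = inDegree R v} from ⟨v, Or.inl rfl⟩)

theorem minDegree_le_inDegree {V : Type*} (R : V → V → Prop) (v : V) :
    minDegree R ≤ inDegree R v :=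
  Nat.sInf_le (show _ ∈ {n | ∃ v, n = outDegree R v ∨ n = inDegree R v} from ⟨v, Or.inr rfl⟩)

theorem not_MDArc_self {G : Type*} [Group G] {S0 S1 : Set G} (T0 T1 : Set G)
    (hS0 : (1 : G) ∉ S0) (hS1 : (1 : G) ∉ S1) (v : G × Bool) : ¬ MDArc S0 S1 T0 T1 v v := by
  rintro (⟨-, -, s, hs, h⟩ | ⟨-, -, s, hs, h⟩ | ⟨h, h', -⟩ | ⟨h, h', -⟩)
  · exact hS0 (right_eq_mul.mp h ▸ hs)
  · exact hS1 (right_eq_mul.mp h ▸ hs)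
  · simp [h] at h'
  · simp [h] at h'

/-- if `X` is max-λ but not super-λ, then a λ-superatom has at
least `δ(X)` vertices. -/
theorem mixedCayley_superatom_card_ge
    {G : Type*} [Group G] [Fintype G] (S0 S1 T0 T1 : Set G)
    (hS0 : (1 : G) ∉ S0) (hS1 : (1 : G) ∉ S1)
    (hT0 : T0.Nonempty) (hT1 : T1.Nonempty)
    (hsc : DigraphStronglyConnected (MDArc S0 S1 T0 T1))
    (hmax : arcConnectivity (MDArc S0 S1 T0 T1) = minDegree (MDArc S0 S1 T0 T1))
    (hnsuper : ¬ SuperLambda (MDArc S0 S1 T0 T1))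
    (A : Set (G × Bool)) (hA : IsLambdaSuperatom (MDArc S0 S1 T0 T1) A) :
    minDegree (MDArc S0 S1 T0 T1) ≤ A.ncard := by
  have hloop := not_MDArc_self T0 T1 hS0 hS1
  obtain ⟨⟨-, -, hω⟩ | ⟨-, -, hω⟩, hcard, -⟩ := hA
  · exact le_ncard_of_omegaPlus_ncard_le hloop (minDegree_le_outDegree _) hcard
      (hω.trans hmax).le
  · exact le_ncard_of_omegaPlus_ncard_le (R := flip (MDArc S0 S1 T0 T1)) hloop
      (minDegree_le_inDegree _) hcard
      ((ncard_omegaPlus_flip _ A).trans (hω.trans hmax)).le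
end

section
/- Let X = MD(G, S0, S1, T0, T1) be a strongly connected mixed Cayley digraph that is max-λ but not super-λ. If X is neither a directed cycle nor a cycle and X does not belong to the class F, then any two distinct positive λ-superatoms of X are vertex disjoint, and any two distinct negative λ-superatoms of X are vertex disjoint. -/
open Set Pointwise

/-- The digraph is a directed cycle. -/
def IsDirectedCycleDigraph {V : Type*} (R : V → V → Prop) : Prop :=
  DigraphStronglyConnected R ∧ ∀ v, outDegree R v = 1 ∧ inDegree R v = 1

/-- The digraph is a cycle: the digraph obtained from an undirected cycle by
replacing each edge with two oppositely oriented arcs. -/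
def IsBidirectedCycleDigraph {V : Type*} (R : V → V → Prop) : Prop :=
  DigraphStronglyConnected R ∧ (∀ u v, R u v → R v u) ∧
    ∀ v, outDegree R v = 2 ∧ inDegree R v = 2

/-- The arc relation of the Cayley digraph `Cay(G,S)`. -/
def CayRel {G : Type*} [Group G] (S : Set G) (g h : G) : Prop :=
  ∃ s ∈ S, h = s * g

/-- A digraph is a disjoint union of directed cycles iff every vertex has
out-degree and in-degree one. -/
def IsUnionOfDirectedCycles {V : Type*} (R : V → V → Prop) : Prop :=
  ∀ v, outDegree R v = 1 ∧ inDegree R v = 1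

/-- A digraph is a disjoint union of directed cycles of length two iff every
vertex has out-degree and in-degree one and the arc relation is symmetric. -/
def IsUnionOfTwoCycles {V : Type*} (R : V → V → Prop) : Prop :=
  IsUnionOfDirectedCycles R ∧ ∀ u v, R u v → R v u

/-- The arc relation of the bipartite part `BD(G,T0,T1)` of the mixed Cayley
digraph: the arcs between `X_0` and `X_1`. -/
def BDArc {G : Type*} [Group G] (T0 T1 : Set G) (u v : G × Bool) : Prop :=
  (u.2 = false ∧ v.2 = true ∧ ∃ t ∈ T0, v.1 = t * u.1) ∨
  (u.2 = true ∧ v.2 = false ∧ ∃ t ∈ T1, u.1 = t * v.1)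

/-- The class `F`: one of `Cay(G×{0},S0)`, `Cay(G×{1},S1)` is a disjoint union
of directed cycles, the other is a disjoint union of directed cycles of length
two, and the bipartite part `BD(G,T0,T1)` is a disjoint union of directed
cycles of length two. -/
def InClassF {G : Type*} [Group G] (S0 S1 T0 T1 : Set G) : Prop :=
  ((IsUnionOfDirectedCycles (CayRel S0) ∧ IsUnionOfTwoCycles (CayRel S1)) ∨
   (IsUnionOfDirectedCycles (CayRel S1) ∧ IsUnionOfTwoCycles (CayRel S0))) ∧
  IsUnionOfTwoCycles (BDArc T0 T1)

section Cut

variable {V : Type*}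

open Classical in
/-- The indicator of the arc relation. -/
noncomputable def arcInd (R : V → V → Prop) (u w : V) : ℕ :=
  if R u w then 1 else 0

theorem arcInd_le_one (R : V → V → Prop) (u w : V) : arcInd R u w ≤ 1 := by
  unfold arcInd; split_ifs <;> simp

theorem arcInd_eq_one {R : V → V → Prop} {u w : V} : arcInd R u w = 1 ↔ R u w := by
  unfold arcInd; split_ifs <;> simp_all

variable [Fintype V]

open Classical in
/-- The number of out-neighbours of `u` lying outside `C`. -/
noncomputable def escapeCount (R : V → V → Prop) (u : V) (C : Finset V) : ℕ :=
  (Finset.univ.filter fun w => R u w ∧ w ∉ C).card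

/-- The number of arcs leaving `C`. -/
noncomputable def cutSize (R : V → V → Prop) (C : Finset V) : ℕ :=
  ∑ u ∈ C, escapeCount R u C

theorem outDegree_eq_escapeCount (R : V → V → Prop) (u : V) :
    outDegree R u = escapeCount R u ∅ := by
  classical
  unfold outDegree escapeCount
  rw [Set.ncard_eq_toFinset_card']
  congr 1
  ext; simp

variable [DecidableEq V]

theorem escapeCount_insert (R : V → V → Prop) (u x : V) (C : Finset V) (hx : x ∉ C) :
    escapeCount R u (insert x C) + arcInd R u x = escapeCount R u C := by
  classical
  unfold escapeCount arcInd
  split_ifs with h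
  · rw [← Finset.card_insert_of_notMem (a := x) (by simp)]
    congr 1
    ext w
    by_cases hw : w = x
    · subst hw; simp [h, hx]
    · simp [hw]
  · rw [add_zero]
    congr 1
    ext w
    by_cases hw : w = x
    · subst hw; simp [h]
    · simp [hw]

open Classical in
theorem cutSize_eq_sum (R : V → V → Prop) (C : Finset V) :
    cutSize R C = ∑ u, ∑ w, if R u w ∧ u ∈ C ∧ w ∉ C then 1 else 0 := by
  unfold cutSize escapeCount
  rw [← Finset.sum_filter_add_sum_filter_not Finset.univ (· ∈ C)]
  rw [Finset.sum_eq_zero (s := Finset.univ.filter fun x => x ∉ C), add_zero]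
  · rw [Finset.filter_univ_mem]
    refine Finset.sum_congr rfl fun u hu => ?_
    simp only [hu, true_and, Finset.card_filter]
    congr!
  · intro u hu
    have : u ∉ C := by simpa using hu
    simp [this]

theorem cutSize_eq_ncard (R : V → V → Prop) (C : Finset V) :
    cutSize R C = (omegaPlus R (C : Set V)).ncard := by
  classical
  rw [cutSize_eq_sum, Set.ncard_eq_toFinset_card', omegaPlus, Set.toFinset_ofPred,
    Finset.card_filter, Fintype.sum_prod_type]
  simp

theorem cutSize_flip (R : V → V → Prop) (C : Finset V) :
    cutSize (fun u v => R v u) C = cutSize R Cᶜ := by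
  classical
  rw [cutSize_eq_sum, cutSize_eq_sum, Finset.sum_comm]
  refine Finset.sum_congr rfl fun u _ => Finset.sum_congr rfl fun w _ => ?_
  simp [and_comm]

theorem cutSize_inter_add_cutSize_union_le (R : V → V → Prop) (A B : Finset V) :
    cutSize R (A ∩ B) + cutSize R (A ∪ B) ≤ cutSize R A + cutSize R B := by
  classical
  simp only [cutSize_eq_sum, ← Finset.sum_add_distrib]
  refine Finset.sum_le_sum fun u _ => Finset.sum_le_sum fun w _ => ?_
  by_cases h : R u w <;> by_cases h1 : u ∈ A <;> by_cases h2 : u ∈ B <;> by_cases h3 : w ∈ A <;>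
    by_cases h4 : w ∈ B <;> simp [h, h1, h2, h3, h4]

theorem cutSize_map (R R' : V → V → Prop) (e : V ≃ V)
    (h : ∀ u w, R' (e u) (e w) ↔ R u w) (C : Finset V) :
    cutSize R' (C.map e.toEmbedding) = cutSize R C := by
  classical
  rw [cutSize_eq_sum, cutSize_eq_sum, ← Equiv.sum_comp e]
  refine Finset.sum_congr rfl fun u _ => ?_
  rw [← Equiv.sum_comp e]
  refine Finset.sum_congr rfl fun w _ => ?_
  simp [h]

theorem cutSize_singleton {R : V → V → Prop} (hR : ∀ v, ¬ R v v) (v : V) :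
    cutSize R {v} = outDegree R v := by
  have h := escapeCount_insert R v v ∅ (by simp)
  have h0 : arcInd R v v = 0 := by simp [arcInd, hR]
  rw [outDegree_eq_escapeCount]
  simpa [cutSize, h0] using h

theorem cutSize_pair {R : V → V → Prop} (hR : ∀ v, ¬ R v v) {u v : V} (huv : u ≠ v) :
    cutSize R {u, v} + arcInd R u v + arcInd R v u = outDegree R u + outDegree R v := by
  have e (x : V) := escapeCount_insert R x u {v} (by simpa using huv)
  have f (x : V) := escapeCount_insert R x v ∅ (by simp)
  have h0 (x : V) : arcInd R x x = 0 := by simp [arcInd, hR]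
  have := e u; have := e v; have := f u; have := f v; have := h0 u; have := h0 v
  rw [outDegree_eq_escapeCount, outDegree_eq_escapeCount, cutSize, Finset.sum_pair huv]
  simp only [insert_empty_eq] at *
  omega

/-- `l` is a positive lower bound for all cuts of `R`, and a cut of size `l` with at least two
vertices on its initial side has at least `k` vertices there. -/
structure IsCutBound (R : V → V → Prop) (l k : ℕ) : Prop where
  loopless : ∀ v, ¬ R v v
  pos : 0 < l
  two_le : 2 ≤ k
  half : 2 * k ≤ Fintype.card V
  lower : ∀ C : Finset V, C.Nonempty → C ≠ Finset.univ → l ≤ cutSize R C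
  minimal : ∀ C : Finset V, C.Nonempty → C ≠ Finset.univ → cutSize R C = l → 2 ≤ C.card →
    k ≤ C.card

omit [DecidableEq V] in
theorem IsCutBound.ne_univ {R : V → V → Prop} {l k : ℕ} (h : IsCutBound R l k) {C : Finset V}
    (hC : C.card < 2 * k) : C ≠ Finset.univ := by
  rintro rfl
  have := h.half
  rw [Finset.card_univ] at hC
  omega

theorem IsCutBound.map {R R' : V → V → Prop} {l k : ℕ} (h : IsCutBound R l k) (e : V ≃ V)
    (he : ∀ u w, R' (e u) (e w) ↔ R u w) : IsCutBound R' l k := by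
  have key (C : Finset V) : cutSize R' C = cutSize R (C.map e.symm.toEmbedding) := by
    rw [← cutSize_map R R' e he, Finset.map_map]
    congr 1
    ext x; simp
  have hne (C : Finset V) (hC : C ≠ Finset.univ) : C.map e.symm.toEmbedding ≠ Finset.univ := by
    intro h'
    apply hC
    rw [← Finset.card_eq_iff_eq_univ] at h' ⊢
    simpa using h'
  refine ⟨fun v hv => ?_, h.pos, h.two_le, h.half, fun C h1 h2 => ?_, fun C h1 h2 h3 h4 => ?_⟩
  · rw [← e.apply_symm_apply v, he] at hv
    exact h.loopless _ hv
  · rw [key]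
    exact h.lower _ (by simpa using h1) (hne C h2)
  · have := h.minimal (C.map e.symm.toEmbedding) (by simpa using h1) (hne C h2)
      (by rw [← key, h3]) (by simpa using h4)
    simpa using this

theorem IsCutBound.le_outDegree {R : V → V → Prop} {l k : ℕ} (h : IsCutBound R l k) (v : V) :
    l ≤ outDegree R v := by
  rw [← cutSize_singleton h.loopless]
  exact h.lower _ (by simp) (h.ne_univ (by have := h.two_le; simp; omega))

theorem IsCutBound.le_inDegree {R : V → V → Prop} {l k : ℕ} (h : IsCutBound R l k) (v : V) :
    l ≤ inDegree R v := by
  have : inDegree R v = cutSize (fun u v => R v u) {v} :=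
    (cutSize_singleton (R := fun u v => R v u) h.loopless v).symm
  have hc : Finset.card ({v}ᶜ : Finset V) + 1 = Fintype.card V := by
    rw [← Finset.card_compl_add_card {v}]; simp
  have := h.two_le
  have := h.half
  rw [‹inDegree R v = _›, cutSize_flip]
  refine h.lower _ (Finset.card_pos.1 (by omega)) fun h' => ?_
  rw [← Finset.card_eq_iff_eq_univ] at h'
  omega

/-- Distinct minimum sets meet in at most one vertex, whose out-degree is then `l`. -/
theorem IsCutBound.inter_eq {R : V → V → Prop} {l k : ℕ} (h : IsCutBound R l k)
    {A B : Finset V} (hA : A.card = k ∧ cutSize R A = l) (hB : B.card = k ∧ cutSize R B = l)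
    (hAB : A ≠ B) {v : V} (hvA : v ∈ A) (hvB : v ∈ B) : A ∩ B = {v} ∧ outDegree R v = l := by
  have hv : v ∈ A ∩ B := by simp [hvA, hvB]
  have hpos : 0 < (A ∩ B).card := Finset.card_pos.2 ⟨v, hv⟩
  have hlt : (A ∩ B).card < k := by
    rw [← hA.1]
    refine Finset.card_lt_card (Finset.ssubset_iff_subset_ne.2 ⟨Finset.inter_subset_left, ?_⟩)
    intro h'
    have : A ⊆ B := Finset.inter_eq_left.1 h'
    exact hAB (Finset.eq_of_subset_of_card_le this (by omega))
  have hcard := Finset.card_union_add_card_inter A B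
  have h1 := h.lower (A ∩ B) ⟨v, hv⟩ (h.ne_univ (by omega))
  have h2 := h.lower (A ∪ B) ⟨v, by simp [hvA]⟩ (h.ne_univ (by omega))
  have h3 := cutSize_inter_add_cutSize_union_le R A B
  have h4 : cutSize R (A ∩ B) = l := by omega
  have h5 : (A ∩ B).card = 1 := by
    by_contra hne
    have := h.minimal (A ∩ B) ⟨v, hv⟩ (h.ne_univ (by omega)) h4 (by omega)
    omega
  obtain ⟨x, hx⟩ := Finset.card_eq_one.1 h5
  have hxv : v = x := by simpa [hx] using hv
  subst hxv
  exact ⟨hx, by rw [← cutSize_singleton h.loopless, ← hx, h4]⟩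

theorem IsCutBound.card_mul_outDegree_le {R : V → V → Prop} {l k : ℕ} (h : IsCutBound R l k)
    (𝒜 : Finset (Finset V)) (h𝒜 : ∀ A ∈ 𝒜, A.card = k ∧ cutSize R A = l) (v : V)
    (hv : ∀ A ∈ 𝒜, v ∈ A) :
    𝒜.card * outDegree R v ≤ ∑ A ∈ 𝒜, escapeCount R v A + outDegree R v := by
  classical
  have hsplit (A : Finset V) :
      outDegree R v = escapeCount R v A + (Finset.univ.filter fun w => R v w ∧ w ∈ A).card := by
    rw [outDegree_eq_escapeCount]
    unfold escapeCount
    rw [← Finset.card_union_of_disjoint]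
    · congr 1
      ext w
      simp
      tauto
    · rw [Finset.disjoint_left]
      intro w
      simp
      tauto
  have hsum : ∑ A ∈ 𝒜, (Finset.univ.filter fun w => R v w ∧ w ∈ A).card ≤ outDegree R v := by
    rw [← Finset.card_biUnion]
    · rw [outDegree_eq_escapeCount]
      refine Finset.card_le_card fun w => ?_
      simp
      tauto
    · intro A hA B hB hAB
      rw [Function.onFun, Finset.disjoint_left]
      intro w hw1 hw2
      simp only [Finset.mem_filter, Finset.mem_univ, true_and] at hw1 hw2
      have := (h.inter_eq (h𝒜 A hA) (h𝒜 B hB) hAB (hv A hA) (hv B hB)).1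
      have hw : w ∈ A ∩ B := by simp [hw1.2, hw2.2]
      rw [this, Finset.mem_singleton] at hw
      subst hw
      exact h.loopless _ hw1.1
  calc 𝒜.card * outDegree R v = ∑ A ∈ 𝒜, outDegree R v := by simp
    _ = ∑ A ∈ 𝒜, escapeCount R v A +
        ∑ A ∈ 𝒜, (Finset.univ.filter fun w => R v w ∧ w ∈ A).card := by
      rw [← Finset.sum_add_distrib]
      exact Finset.sum_congr rfl fun A _ => hsplit A
    _ ≤ _ := by omega

end Cut
section MixedCayley

variable {G : Type*} [Group G]

theorem mdArc_false_false {S0 S1 T0 T1 : Set G} {g h : G} :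
    MDArc S0 S1 T0 T1 (g, false) (h, false) ↔ h * g⁻¹ ∈ S0 := by
  simp [MDArc, ← mul_inv_eq_iff_eq_mul]

theorem mdArc_true_true {S0 S1 T0 T1 : Set G} {g h : G} :
    MDArc S0 S1 T0 T1 (g, true) (h, true) ↔ h * g⁻¹ ∈ S1 := by
  simp [MDArc, ← mul_inv_eq_iff_eq_mul]

theorem mdArc_false_true {S0 S1 T0 T1 : Set G} {g h : G} :
    MDArc S0 S1 T0 T1 (g, false) (h, true) ↔ h * g⁻¹ ∈ T0 := by
  simp [MDArc, ← mul_inv_eq_iff_eq_mul]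

theorem mdArc_true_false {S0 S1 T0 T1 : Set G} {g h : G} :
    MDArc S0 S1 T0 T1 (g, true) (h, false) ↔ g * h⁻¹ ∈ T1 := by
  simp [MDArc, ← mul_inv_eq_iff_eq_mul]

theorem mdArc_mul_right {S0 S1 T0 T1 : Set G} (c : G) (u w : G × Bool) :
    MDArc S0 S1 T0 T1 (u.1 * c, u.2) (w.1 * c, w.2) ↔ MDArc S0 S1 T0 T1 u w := by
  obtain ⟨g, _ | _⟩ := u <;> obtain ⟨h, _ | _⟩ := w <;>
    simp [mdArc_false_false, mdArc_false_true, mdArc_true_false, mdArc_true_true]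

theorem mdArc_loopless {S0 S1 T0 T1 : Set G} (hS0 : (1 : G) ∉ S0) (hS1 : (1 : G) ∉ S1)
    (v : G × Bool) : ¬ MDArc S0 S1 T0 T1 v v := by
  obtain ⟨g, _ | _⟩ := v <;> simpa [mdArc_false_false, mdArc_true_true]

theorem mdArc_flip {S0 S1 T0 T1 : Set G} :
    (fun u w => MDArc S0 S1 T0 T1 w u) = MDArc S0⁻¹ S1⁻¹ T1 T0 := by
  funext ⟨g, i⟩ ⟨h, j⟩
  cases i <;> cases j <;>
    simp [mdArc_false_false, mdArc_false_true, mdArc_true_false, mdArc_true_true]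

theorem mdArc_swap {S0 S1 T0 T1 : Set G} (u w : G × Bool) :
    MDArc S1 S0 T1⁻¹ T0⁻¹ (u.1, !u.2) (w.1, !w.2) ↔ MDArc S0 S1 T0 T1 u w := by
  obtain ⟨g, _ | _⟩ := u <;> obtain ⟨h, _ | _⟩ := w <;>
    simp [mdArc_false_false, mdArc_false_true, mdArc_true_false, mdArc_true_true]

omit [Group G] in
theorem ncard_union_fiber [Finite G] {S T : Set G} {f g : G → G} (hf : f.Injective)
    (hg : g.Injective) (i j : Bool) (hij : i ≠ j) :
    ((fun s => (f s, i)) '' S ∪ (fun t => (g t, j)) '' T).ncard = S.ncard + T.ncard := by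
  rw [Set.ncard_union_eq, Set.ncard_image_of_injective, Set.ncard_image_of_injective]
  · intro a b hab
    exact hg (congrArg Prod.fst hab)
  · intro a b hab
    exact hf (congrArg Prod.fst hab)
  · rw [Set.disjoint_left]
    rintro _ ⟨a, _, rfl⟩ ⟨b, _, hb⟩
    exact hij (congrArg Prod.snd hb).symm

theorem outDegree_mdArc_false [Finite G] (S0 S1 T0 T1 : Set G) (g : G) :
    outDegree (MDArc S0 S1 T0 T1) (g, false) = S0.ncard + T0.ncard := by
  rw [← ncard_union_fiber (mul_left_injective g) (mul_left_injective g) false true (by simp),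
    outDegree]
  congr 1
  ext ⟨h, _ | _⟩ <;> simp [mdArc_false_false, mdArc_false_true, ← eq_mul_inv_iff_mul_eq]

theorem outDegree_mdArc_true [Finite G] (S0 S1 T0 T1 : Set G) (g : G) :
    outDegree (MDArc S0 S1 T0 T1) (g, true) = S1.ncard + T1.ncard := by
  rw [← ncard_union_fiber (S := S1) (T := T1) (mul_left_injective g)
    ((mul_left_injective g).comp inv_injective) true false (by simp), outDegree]
  congr 1
  ext ⟨h, _ | _⟩
  · simp [mdArc_true_false, inv_mul_eq_iff_eq_mul, ← mul_inv_eq_iff_eq_mul]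
  · simp [mdArc_true_true, ← eq_mul_inv_iff_mul_eq]

theorem inDegree_mdArc_false [Finite G] (S0 S1 T0 T1 : Set G) (g : G) :
    inDegree (MDArc S0 S1 T0 T1) (g, false) = S0.ncard + T1.ncard := by
  rw [← Set.ncard_inv S0, ← outDegree_mdArc_false S0⁻¹ S1⁻¹ T1 T0 g, ← mdArc_flip]
  rfl

theorem inDegree_mdArc_true [Finite G] (S0 S1 T0 T1 : Set G) (g : G) :
    inDegree (MDArc S0 S1 T0 T1) (g, true) = S1.ncard + T0.ncard := by
  rw [← Set.ncard_inv S1, ← outDegree_mdArc_true S0⁻¹ S1⁻¹ T1 T0 g, ← mdArc_flip]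
  rfl

omit [Group G] in
theorem arcInd_le_ncard {V : Type*} [Finite G] {R : V → V → Prop} {u w : V} {S : Set G} {x : G}
    (h : R u w → x ∈ S) : arcInd R u w ≤ S.ncard := by
  unfold arcInd
  split_ifs with hR
  · exact (Set.ncard_pos (Set.toFinite _)).2 ⟨x, h hR⟩
  · simp

omit [Group G] in
theorem arcInd_add_arcInd_le_ncard {V : Type*} [Finite G] {R : V → V → Prop} {u w u' w' : V}
    {S : Set G} {x y : G} (hxy : x ≠ y) (h : R u w → x ∈ S) (h' : R u' w' → y ∈ S) :
    arcInd R u w + arcInd R u' w' ≤ S.ncard := by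
  have h1 := arcInd_le_ncard h
  have h2 := arcInd_le_ncard h'
  by_cases hR : R u w
  · by_cases hR' : R u' w'
    · rw [arcInd_eq_one.2 hR, arcInd_eq_one.2 hR', one_add_one_eq_two, ← Set.ncard_pair hxy]
      exact Set.ncard_le_ncard (Set.insert_subset (h hR) (by simpa using h' hR'))
    · simpa [arcInd, hR'] using h1
  · simpa [arcInd, hR] using h2

/-- The connection sets of directed cycles, of bidirected cycles with no arcs inside the two
halves, and of the members of the class `F`. -/
def IsExceptional (S0 S1 T0 T1 : Set G) : Prop :=
  (S0 = ∅ ∧ S1 = ∅ ∧ T0.ncard = 1 ∧ T1.ncard = 1) ∨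
  (S0 = ∅ ∧ S1 = ∅ ∧ T0 = T1 ∧ T0.ncard = 2) ∨
  (S0.ncard = 1 ∧ S1.ncard = 1 ∧ T0.ncard = 1 ∧ T0 = T1 ∧ (S0 = S0⁻¹ ∨ S1 = S1⁻¹))

theorem IsExceptional.of_swap {S0 S1 T0 T1 : Set G} (h : IsExceptional S1 S0 T1⁻¹ T0⁻¹) :
    IsExceptional S0 S1 T0 T1 := by
  simp only [IsExceptional, Set.ncard_inv, inv_inj] at h ⊢
  rcases h with ⟨h1, h2, h3, h4⟩ | ⟨h1, h2, rfl, h4⟩ | ⟨h1, h2, h3, rfl, h4⟩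
  · exact Or.inl ⟨h2, h1, h4, h3⟩
  · exact Or.inr (Or.inl ⟨h2, h1, rfl, h4⟩)
  · exact Or.inr (Or.inr ⟨h2, h1, h3, rfl, h4.symm⟩)

theorem IsExceptional.of_flip {S0 S1 T0 T1 : Set G} (h : IsExceptional S0⁻¹ S1⁻¹ T1 T0) :
    IsExceptional S0 S1 T0 T1 := by
  simp only [IsExceptional, Set.ncard_inv, Set.inv_eq_empty, inv_inj] at h ⊢
  rcases h with ⟨h1, h2, h3, h4⟩ | ⟨h1, h2, rfl, h4⟩ | ⟨h1, h2, h3, rfl, h4⟩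
  · exact Or.inl ⟨h1, h2, h4, h3⟩
  · exact Or.inr (Or.inl ⟨h1, h2, rfl, h4⟩)
  · exact Or.inr (Or.inr ⟨h1, h2, h3, rfl, h4⟩)

theorem isExceptional_of_pairs_false_true [Fintype G] [DecidableEq G] {S0 S1 T0 T1 : Set G}
    {l k : ℕ} (h : IsCutBound (MDArc S0 S1 T0 T1) l k) (hT0 : T0.Nonempty) (hT1 : T1.Nonempty)
    {x y z : G} (hxy : x ≠ y) (hx : outDegree (MDArc S0 S1 T0 T1) (x, false) = l)
    (hA : cutSize (MDArc S0 S1 T0 T1) {(x, false), (y, false)} = l)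
    (hB : cutSize (MDArc S0 S1 T0 T1) {(x, false), (z, true)} = l) :
    IsExceptional S0 S1 T0 T1 := by
  set R := MDArc S0 S1 T0 T1 with hR
  have t0 := (Set.ncard_pos (Set.toFinite _)).2 hT0
  have t1 := (Set.ncard_pos (Set.toFinite _)).2 hT1
  have hA' := cutSize_pair h.loopless (u := (x, false)) (v := (y, false)) (by simpa using hxy)
  have hB' := cutSize_pair h.loopless (u := (x, false)) (v := (z, true)) (by simp)
  have hin := h.le_inDegree (x, true)
  have hout := h.le_outDegree (x, true)
  have dF (u : G) : outDegree R (u, false) = S0.ncard + T0.ncard := outDegree_mdArc_false ..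
  have dT (u : G) : outDegree R (u, true) = S1.ncard + T1.ncard := outDegree_mdArc_true ..
  have dI (u : G) : inDegree R (u, true) = S1.ncard + T0.ncard := inDegree_mdArc_true ..
  simp only [dF, dT, dI] at hx hA' hB' hin hout
  have c1 := arcInd_le_ncard (R := R) (u := (x, false)) (w := (y, false)) mdArc_false_false.1
  have c2 := arcInd_le_ncard (R := R) (u := (y, false)) (w := (x, false)) mdArc_false_false.1
  have c3 := arcInd_le_ncard (R := R) (u := (x, false)) (w := (z, true)) mdArc_false_true.1
  have c4 := arcInd_le_ncard (R := R) (u := (z, true)) (w := (x, false)) mdArc_true_false.1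
  have d1 := arcInd_le_one R (x, false) (y, false)
  have d2 := arcInd_le_one R (y, false) (x, false)
  have d3 := arcInd_le_one R (x, false) (z, true)
  have d4 := arcInd_le_one R (z, true) (x, false)
  have e1 : arcInd R (x, false) (y, false) = 1 := by omega
  have e2 : arcInd R (y, false) (x, false) = 1 := by omega
  have e3 : arcInd R (x, false) (z, true) = 1 := by omega
  have e4 : arcInd R (z, true) (x, false) = 1 := by omega
  have f1 : S0.ncard = 1 := by omega
  have f2 : S1.ncard = 1 := by omega
  have f3 : T0.ncard = 1 := by omega
  have f4 : T1.ncard = 1 := by omega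
  rw [arcInd_eq_one, hR] at e1 e2 e3 e4
  rw [mdArc_false_false] at e1 e2
  rw [mdArc_false_true] at e3
  rw [mdArc_true_false] at e4
  refine Or.inr (Or.inr ⟨f1, f2, f3, ?_, Or.inl ?_⟩)
  · obtain ⟨c, rfl⟩ := Set.ncard_eq_one.1 f3
    obtain ⟨d, rfl⟩ := Set.ncard_eq_one.1 f4
    rw [Set.mem_singleton_iff] at e3 e4
    rw [← e3, ← e4]
  · obtain ⟨c, rfl⟩ := Set.ncard_eq_one.1 f1
    rw [Set.mem_singleton_iff] at e1 e2
    rw [Set.inv_singleton]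
    nth_rewrite 1 [← e2]
    rw [← e1]
    simp

theorem isExceptional_of_pairs [Fintype G] [DecidableEq G] {S0 S1 T0 T1 : Set G} {l k : ℕ}
    (h : IsCutBound (MDArc S0 S1 T0 T1) l k) (hT0 : T0.Nonempty) (hT1 : T1.Nonempty)
    {x : G} {a b : G × Bool} (ha : (x, false) ≠ a) (hb : (x, false) ≠ b) (hab : a ≠ b)
    (hx : outDegree (MDArc S0 S1 T0 T1) (x, false) = l)
    (hA : cutSize (MDArc S0 S1 T0 T1) {(x, false), a} = l)
    (hB : cutSize (MDArc S0 S1 T0 T1) {(x, false), b} = l) :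
    IsExceptional S0 S1 T0 T1 := by
  obtain ⟨y, _ | _⟩ := a <;> obtain ⟨z, _ | _⟩ := b
  rotate_left
  · exact isExceptional_of_pairs_false_true h hT0 hT1 (by simpa using ha) hx hA hB
  · exact isExceptional_of_pairs_false_true h hT0 hT1 (by simpa using hb) hx hB hA
  all_goals
    set R := MDArc S0 S1 T0 T1 with hR
    have t0 := (Set.ncard_pos (Set.toFinite _)).2 hT0
    have t1 := (Set.ncard_pos (Set.toFinite _)).2 hT1
    have hA' := cutSize_pair h.loopless ha
    have hB' := cutSize_pair h.loopless hb
    have hpos := h.pos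
    have hout := h.le_outDegree (x, true)
    have hyz : y ≠ z := by simpa using hab
    have dF (u : G) : outDegree R (u, false) = S0.ncard + T0.ncard := outDegree_mdArc_false ..
    have dT (u : G) : outDegree R (u, true) = S1.ncard + T1.ncard := outDegree_mdArc_true ..
    simp only [dF, dT] at hx hA' hB' hout
  · have c1 := arcInd_le_ncard (R := R) (u := (x, true)) (w := (y, true)) mdArc_true_true.1
    have d1 := arcInd_le_one R (x, false) (y, true)
    have d2 := arcInd_le_one R (y, true) (x, false)
    have d3 := arcInd_le_one R (x, false) (z, true)
    have d4 := arcInd_le_one R (z, true) (x, false)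
    have e1 := arcInd_add_arcInd_le_ncard (R := R) (u := (x, false)) (u' := (x, false))
      (x := y * x⁻¹) (y := z * x⁻¹) (by simpa using hyz) mdArc_false_true.1 mdArc_false_true.1
    have e2 := arcInd_add_arcInd_le_ncard (R := R) (w := (x, false)) (w' := (x, false))
      (x := y * x⁻¹) (y := z * x⁻¹) (by simpa using hyz) mdArc_true_false.1 mdArc_true_false.1
    have s0 : S0 = ∅ := (Set.ncard_eq_zero (Set.toFinite S0)).1 (by omega)
    have s1 : S1 = ∅ := (Set.ncard_eq_zero (Set.toFinite S1)).1 (by omega)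
    by_cases ht : T0.ncard = 1
    · exact Or.inl ⟨s0, s1, ht, by omega⟩
    · have f1 : arcInd R (x, false) (y, true) = 1 := by omega
      have f2 : arcInd R (y, true) (x, false) = 1 := by omega
      have f3 : arcInd R (x, false) (z, true) = 1 := by omega
      have f4 : arcInd R (z, true) (x, false) = 1 := by omega
      rw [arcInd_eq_one, hR] at f1 f2 f3 f4
      rw [mdArc_false_true] at f1 f3
      rw [mdArc_true_false] at f2 f4
      have hp : ({y * x⁻¹, z * x⁻¹} : Set G).ncard = 2 := Set.ncard_pair (by simpa using hyz)
      refine Or.inr (Or.inl ⟨s0, s1, ?_, by omega⟩)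
      rw [← Set.eq_of_subset_of_ncard_le (s := {y * x⁻¹, z * x⁻¹}) (t := T0)
          (Set.insert_subset f1 (by simpa using f3)) (by omega),
        ← Set.eq_of_subset_of_ncard_le (s := {y * x⁻¹, z * x⁻¹}) (t := T1)
          (Set.insert_subset f2 (by simpa using f4)) (by omega)]
  · have c1 := arcInd_le_ncard (R := R) (u := (y, false)) (w := (x, false)) mdArc_false_false.1
    have d1 := arcInd_le_one R (x, false) (y, false)
    have d2 := arcInd_le_one R (y, false) (x, false)
    have d3 := arcInd_le_one R (x, false) (z, false)
    have d4 := arcInd_le_one R (z, false) (x, false)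
    have e1 := arcInd_add_arcInd_le_ncard (R := R) (u := (x, false)) (u' := (x, false))
      (x := y * x⁻¹) (y := z * x⁻¹) (by simpa using hyz) mdArc_false_false.1 mdArc_false_false.1
    omega

/-- Averaging over all minimum sets: if two of them meet in the half `false` and have at least
three vertices, then they have exactly three, and some minimum set has a vertex in the half
`true` all of whose out-neighbours lie in it. -/
theorem IsCutBound.card_eq_three_of_inter [Fintype G] [DecidableEq G]
    {R : G × Bool → G × Bool → Prop}
    {l k : ℕ} (h : IsCutBound R l k)
    (hR : ∀ c (u w : G × Bool), R (u.1 * c, u.2) (w.1 * c, w.2) ↔ R u w)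
    {A B : Finset (G × Bool)} (hA : A.card = k ∧ cutSize R A = l)
    (hB : B.card = k ∧ cutSize R B = l) (hAB : A ≠ B) {x : G} (hxA : (x, false) ∈ A)
    (hxB : (x, false) ∈ B) (hk : 3 ≤ k) :
    ∃ C : Finset (G × Bool), C.card = 3 ∧ k = 3 ∧ cutSize R C = l ∧ (∃ g, (g, true) ∈ C) ∧
      ∀ g, (g, true) ∈ C → escapeCount R (g, true) C = 0 := by
  set 𝒜 : Finset (Finset (G × Bool)) :=
    Finset.univ.filter fun C => C.card = k ∧ cutSize R C = l with h𝒜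
  have mem (C : Finset (G × Bool)) : C ∈ 𝒜 ↔ C.card = k ∧ cutSize R C = l := by simp [h𝒜]
  let N : G × Bool → ℕ := fun v => (𝒜.filter (v ∈ ·)).card
  let E : G × Bool → ℕ := fun v => ∑ C ∈ 𝒜.filter (v ∈ ·), escapeCount R v C
  have hN (g : G) (i : Bool) : N (g, i) = N (x, i) := by
    let e : G × Bool ≃ G × Bool := (Equiv.mulRight (g⁻¹ * x)).prodCongr (Equiv.refl _)
    have he (u w : G × Bool) : R (e u) (e w) ↔ R u w := hR _ u w
    refine Finset.card_bij (fun C _ => C.map e.toEmbedding) ?_ ?_ ?_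
    · intro C hC
      simp only [Finset.mem_filter, mem] at hC ⊢
      refine ⟨⟨by simpa using hC.1.1, by rw [cutSize_map R R e he, hC.1.2]⟩, ?_⟩
      rw [Finset.mem_map]
      exact ⟨_, hC.2, by simp [e]⟩
    · intro C _ D _ hCD
      exact Finset.map_injective _ hCD
    · intro C hC
      simp only [Finset.mem_filter, mem] at hC
      have hmap : (C.map e.symm.toEmbedding).map e.toEmbedding = C := by
        rw [Finset.map_map]; ext; simp
      refine ⟨C.map e.symm.toEmbedding, ?_, hmap⟩
      simp only [Finset.mem_filter, mem]
      refine ⟨⟨by simpa using hC.1.1, by rw [← cutSize_map R R e he, hmap, hC.1.2]⟩, ?_⟩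
      rw [Finset.mem_map]
      exact ⟨_, hC.2, by simp [e, Equiv.symm_apply_eq]⟩
  have hcard : 𝒜.card * k = ∑ v, N v := by
    have : ∑ C ∈ 𝒜, ∑ v ∈ C, 1 = ∑ v, ∑ C ∈ 𝒜.filter (v ∈ ·), 1 :=
      Finset.sum_comm' (by simp)
    simp only [Finset.sum_const, smul_eq_mul, mul_one] at this
    rw [← this, Finset.sum_congr rfl fun C hC => ((mem C).1 hC).1]
    simp
  have hcut : 𝒜.card * l = ∑ v, E v := by
    have : ∑ C ∈ 𝒜, ∑ v ∈ C, escapeCount R v C = ∑ v, E v :=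
      Finset.sum_comm' (by simp)
    rw [← this, ← smul_eq_mul, ← Finset.sum_const]
    exact Finset.sum_congr rfl fun C hC => ((mem C).1 hC).2.symm
  have hE (v : G × Bool) : (N v - 1) * l ≤ E v := by
    have h1 := h.card_mul_outDegree_le (𝒜.filter (v ∈ ·))
      (fun C hC => (mem C).1 (Finset.mem_filter.1 hC).1) v (fun C hC => (Finset.mem_filter.1 hC).2)
    change N v * outDegree R v ≤ E v + outDegree R v at h1
    calc (N v - 1) * l ≤ (N v - 1) * outDegree R v := Nat.mul_le_mul_left _ (h.le_outDegree v)
      _ = N v * outDegree R v - outDegree R v := by rw [Nat.sub_mul, one_mul]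
      _ ≤ E v := by omega
  have hN2 : 1 < N (x, false) := Finset.one_lt_card.2
    ⟨A, by simp [mem, hA, hxA], B, by simp [mem, hB, hxB], hAB⟩
  rw [Fintype.sum_prod_type] at hcard hcut
  simp only [Fintype.sum_bool, hN, Finset.sum_const, Finset.card_univ, smul_eq_mul] at hcard
  simp only [Fintype.sum_bool, Finset.sum_add_distrib] at hcut
  set n := Fintype.card G with hn
  set N0 := N (x, false)
  set N1 := N (x, true)
  have hnpos : 0 < n := Fintype.card_pos
  have hE0 : n * ((N0 - 1) * l) ≤ ∑ g, E (g, false) := by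
    rw [hn, ← Finset.card_univ, ← smul_eq_mul, ← Finset.sum_const]
    exact Finset.sum_le_sum fun g _ => by simpa [hN] using hE (g, false)
  have hE1 : n * ((N1 - 1) * l) ≤ ∑ g, E (g, true) := by
    rw [hn, ← Finset.card_univ, ← smul_eq_mul, ← Finset.sum_const]
    exact Finset.sum_le_sum fun g _ => by simpa [hN] using hE (g, true)
  have hlow : n * ((N0 - 1) + (N1 - 1)) ≤ 𝒜.card := by
    refine Nat.le_of_mul_le_mul_right ?_ h.pos
    calc n * ((N0 - 1) + (N1 - 1)) * l = n * ((N0 - 1) * l) + n * ((N1 - 1) * l) := by ring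
      _ ≤ 𝒜.card * l := by omega
  have hbound : ((N0 - 1) + (N1 - 1)) * k ≤ N1 + N0 := by
    refine Nat.le_of_mul_le_mul_left ?_ hnpos
    rw [← hcard, ← mul_assoc]
    exact Nat.mul_le_mul_right k hlow
  have h3 : ((N0 - 1) + (N1 - 1)) * 3 ≤ N1 + N0 := (Nat.mul_le_mul_left _ hk).trans hbound
  have hN0 : N0 = 2 := by omega
  have hN1 : N1 = 1 := by omega
  have hk3 : k = 3 := by rw [hN0, hN1] at hbound; omega
  have hM : 𝒜.card = n := by rw [hk3, hN0, hN1] at hcard; omega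
  have hE1' : ∑ g, E (g, true) = 0 := by
    rw [hM] at hcut
    rw [hN0] at hE0
    simp only [Nat.add_one_sub_one, one_mul] at hE0
    omega
  obtain ⟨C, hC⟩ := Finset.card_pos.1 (show 0 < N (x, true) by omega)
  rw [Finset.mem_filter] at hC
  obtain ⟨hC1, hC2⟩ := (mem C).1 hC.1
  refine ⟨C, by omega, hk3, hC2, ⟨x, hC.2⟩, fun g hg => ?_⟩
  have h0 : E (g, true) = 0 := Finset.sum_eq_zero_iff.1 hE1' g (Finset.mem_univ g)
  exact Finset.sum_eq_zero_iff.1 h0 C (Finset.mem_filter.2 ⟨hC.1, hg⟩)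

/-- In a minimum set with three vertices, some vertex in the half `true` has an out-neighbour
outside the set. -/
theorem IsCutBound.false_of_triple [Fintype G] [DecidableEq G] {S0 S1 T0 T1 : Set G} {l : ℕ}
    (h : IsCutBound (MDArc S0 S1 T0 T1) l 3) (hT0 : T0.Nonempty) (hT1 : T1.Nonempty) {x : G}
    (hx : outDegree (MDArc S0 S1 T0 T1) (x, false) = l) {C : Finset (G × Bool)} (hC : C.card = 3)
    (hcut : cutSize (MDArc S0 S1 T0 T1) C = l) {g : G} (hg : (g, true) ∈ C)
    (hesc : ∀ g, (g, true) ∈ C → escapeCount (MDArc S0 S1 T0 T1) (g, true) C = 0) : False := by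
  set R := MDArc S0 S1 T0 T1 with hR
  have t0 := (Set.ncard_pos (Set.toFinite _)).2 hT0
  have t1 := (Set.ncard_pos (Set.toFinite _)).2 hT1
  obtain ⟨a, b, hab, hCe⟩ : ∃ a b, a ≠ b ∧ C.erase (g, true) = {a, b} :=
    Finset.card_eq_two.1 (by rw [Finset.card_erase_of_mem hg, hC])
  have haC : a ∈ C.erase (g, true) := by simp [hCe]
  have hbC : b ∈ C.erase (g, true) := by simp [hCe]
  have hwa : (g, true) ≠ a := (Finset.ne_of_mem_erase haC).symm
  have hwb : (g, true) ≠ b := (Finset.ne_of_mem_erase hbC).symm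
  have hCw : C = {(g, true), a, b} := by rw [← hCe, Finset.insert_erase hg]
  have hpos := h.pos
  have hout := h.le_outDegree (g, true)
  have pair {u v : G × Bool} (huv : u ≠ v) : l + 1 ≤ cutSize R {u, v} := by
    have h2 : Finset.card {u, v} = 2 := Finset.card_pair huv
    have h3 := h.lower {u, v} (by simp) (h.ne_univ (by omega))
    have h4 := h.minimal {u, v} (by simp) (h.ne_univ (by omega))
    by_contra hlt
    have := h4 (by omega) (by omega)
    omega
  have pwa := pair hwa
  have pwb := pair hwb
  have pab := pair hab
  have qwa := cutSize_pair h.loopless hwa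
  have qwb := cutSize_pair h.loopless hwb
  have qab := cutSize_pair h.loopless hab
  have esc (u : G × Bool) : escapeCount R u C + arcInd R u (g, true) + arcInd R u a + arcInd R u b
      = outDegree R u := by
    have h1 := escapeCount_insert R u (g, true) {a, b} (by simp [hwa, hwb])
    have h2 := escapeCount_insert R u a {b} (by simpa using hab)
    have h3 := escapeCount_insert R u b ∅ (by simp)
    rw [outDegree_eq_escapeCount, hCw]
    simp only [insert_empty_eq] at h3
    omega
  have hsum : escapeCount R (g, true) C + (escapeCount R a C + escapeCount R b C) = l := by
    rw [← hcut, cutSize]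
    conv_rhs => rw [hCw]
    rw [Finset.sum_insert (by simp [hwa, hwb]), Finset.sum_pair hab, ← hCw]
  have loop (u : G × Bool) : arcInd R u u = 0 := by
    simp [arcInd, h.loopless]
  have ew := esc (g, true)
  have ea := esc a
  have eb := esc b
  have lw := loop (g, true)
  have la := loop a
  have lb := loop b
  have zw := hesc g hg
  have o1 := arcInd_le_one R (g, true) a
  have o2 := arcInd_le_one R (g, true) b
  have o3 := arcInd_le_one R a b
  have o4 := arcInd_le_one R b a
  have o5 := arcInd_le_one R a (g, true)
  have o6 := arcInd_le_one R b (g, true)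
  have mixed {y z : G} (hz : (z, true) ∈ C) (hy : (y, false) ∈ C)
      (hgz : (g, true) ≠ (z, true))
      (hw : outDegree R (g, true) = arcInd R (g, true) (y, false) + arcInd R (g, true) (z, true))
      (hb : outDegree R (z, true) = arcInd R (z, true) (y, false) + arcInd R (z, true) (g, true)) :
      False := by
    have d1 := arcInd_le_one R (g, true) (y, false)
    have d2 := arcInd_le_one R (z, true) (y, false)
    have d3 := arcInd_le_one R (g, true) (z, true)
    have d4 := arcInd_le_one R (z, true) (g, true)
    have c1 := arcInd_le_ncard (R := R) (u := (g, true)) (w := (z, true)) mdArc_true_true.1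
    have c3 := arcInd_le_ncard (R := R) (u := (z, true)) (w := (g, true)) mdArc_true_true.1
    have c2 := arcInd_add_arcInd_le_ncard (R := R) (w := (y, false)) (w' := (y, false))
      (x := g * y⁻¹) (y := z * y⁻¹) (by simpa using hgz) mdArc_true_false.1 mdArc_true_false.1
    rw [hR, outDegree_mdArc_true, ← hR] at hw hb
    omega
  have haC' := Finset.mem_of_mem_erase haC
  have hbC' := Finset.mem_of_mem_erase hbC
  obtain ⟨y, _ | _⟩ := a <;> obtain ⟨z, _ | _⟩ := b
  · have c1 := arcInd_le_ncard (R := R) (u := (y, false)) (w := (z, false)) mdArc_false_false.1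
    have c2 := arcInd_le_ncard (R := R) (u := (z, false)) (w := (y, false)) mdArc_false_false.1
    have dF (u : G) : outDegree R (u, false) = S0.ncard + T0.ncard := outDegree_mdArc_false ..
    simp only [dF] at hx ea eb qwa qwb qab
    omega
  · have zb := hesc z hbC'
    exact mixed hbC' haC' hwb (by omega) (by omega)
  · have za := hesc y haC'
    exact mixed haC' hbC' hwa (by omega) (by omega)
  · have za := hesc y haC'
    have zb := hesc z hbC'
    omega

theorem IsCutBound.isExceptional_of_mem_false [Fintype G] [DecidableEq G] {S0 S1 T0 T1 : Set G}
    {l k : ℕ} (h : IsCutBound (MDArc S0 S1 T0 T1) l k) (hT0 : T0.Nonempty) (hT1 : T1.Nonempty)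
    {A B : Finset (G × Bool)} (hA : A.card = k ∧ cutSize (MDArc S0 S1 T0 T1) A = l)
    (hB : B.card = k ∧ cutSize (MDArc S0 S1 T0 T1) B = l) (hAB : A ≠ B) {x : G}
    (hxA : (x, false) ∈ A) (hxB : (x, false) ∈ B) : IsExceptional S0 S1 T0 T1 := by
  have hx := (h.inter_eq hA hB hAB hxA hxB).2
  rcases h.two_le.lt_or_eq with hk | rfl
  · obtain ⟨C, hC, rfl, hcut, ⟨g, hg⟩, hesc⟩ :=
      h.card_eq_three_of_inter mdArc_mul_right hA hB hAB hxA hxB hk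
    exact (h.false_of_triple hT0 hT1 hx hC hcut hg hesc).elim
  · have pair {D : Finset (G × Bool)} (hD : D.card = 2) (hxD : (x, false) ∈ D) :
        ∃ a, (x, false) ≠ a ∧ D = {(x, false), a} := by
      obtain ⟨a, ha⟩ := Finset.card_eq_one.1
        (show (D.erase (x, false)).card = 1 by rw [Finset.card_erase_of_mem hxD, hD])
      have haD : a ∈ D.erase (x, false) := by simp [ha]
      exact ⟨a, (Finset.ne_of_mem_erase haD).symm, by rw [← ha, Finset.insert_erase hxD]⟩
    obtain ⟨a, ha, rfl⟩ := pair hA.1 hxA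
    obtain ⟨b, hb, rfl⟩ := pair hB.1 hxB
    exact isExceptional_of_pairs h hT0 hT1 ha hb (fun hab => hAB (by rw [hab])) hx hA.2 hB.2

/-- If two distinct minimum sets meet, then the connection sets are exceptional. -/
theorem IsCutBound.isExceptional_of_mem [Fintype G] [DecidableEq G] {S0 S1 T0 T1 : Set G}
    {l k : ℕ} (h : IsCutBound (MDArc S0 S1 T0 T1) l k) (hT0 : T0.Nonempty) (hT1 : T1.Nonempty)
    {A B : Finset (G × Bool)} (hA : A.card = k ∧ cutSize (MDArc S0 S1 T0 T1) A = l)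
    (hB : B.card = k ∧ cutSize (MDArc S0 S1 T0 T1) B = l) (hAB : A ≠ B) {v : G × Bool}
    (hvA : v ∈ A) (hvB : v ∈ B) : IsExceptional S0 S1 T0 T1 := by
  obtain ⟨x, _ | _⟩ := v
  · exact h.isExceptional_of_mem_false hT0 hT1 hA hB hAB hvA hvB
  · let e : G × Bool ≃ G × Bool := (Equiv.refl G).prodCongr Equiv.boolNot
    have he (u w : G × Bool) :
        MDArc S1 S0 T1⁻¹ T0⁻¹ (e u) (e w) ↔ MDArc S0 S1 T0 T1 u w := mdArc_swap u w
    have key {C : Finset (G × Bool)} (hC : C.card = k ∧ cutSize (MDArc S0 S1 T0 T1) C = l) :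
        (C.map e.toEmbedding).card = k ∧
          cutSize (MDArc S1 S0 T1⁻¹ T0⁻¹) (C.map e.toEmbedding) = l :=
      ⟨by simpa using hC.1, by rw [cutSize_map _ _ e he, hC.2]⟩
    exact ((h.map e he).isExceptional_of_mem_false hT1.inv hT0.inv (key hA) (key hB)
      (fun hm => hAB (Finset.map_injective _ hm)) (x := x) (Finset.mem_map.2 ⟨_, hvA, rfl⟩)
      (Finset.mem_map.2 ⟨_, hvB, rfl⟩)).of_swap

theorem IsExceptional.isDirectedCycle_or_isBidirectedCycle_or_inClassF [Finite G]
    {S0 S1 T0 T1 : Set G} (h : IsExceptional S0 S1 T0 T1)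
    (hsc : DigraphStronglyConnected (MDArc S0 S1 T0 T1)) :
    IsDirectedCycleDigraph (MDArc S0 S1 T0 T1) ∨ IsBidirectedCycleDigraph (MDArc S0 S1 T0 T1) ∨
      InClassF S0 S1 T0 T1 := by
  rcases h with ⟨rfl, rfl, h3, h4⟩ | ⟨rfl, rfl, rfl, h4⟩ | ⟨h1, h2, h3, rfl, h4⟩
  · refine Or.inl ⟨hsc, ?_⟩
    rintro ⟨g, _ | _⟩ <;>
      simp [outDegree_mdArc_false, outDegree_mdArc_true, inDegree_mdArc_false,
        inDegree_mdArc_true, h3, h4]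
  · refine Or.inr (Or.inl ⟨hsc, ?_, ?_⟩)
    · rintro ⟨g, _ | _⟩ ⟨h, _ | _⟩ <;>
        simp [mdArc_false_false, mdArc_false_true, mdArc_true_false, mdArc_true_true]
    · rintro ⟨g, _ | _⟩ <;>
        simp [outDegree_mdArc_false, outDegree_mdArc_true, inDegree_mdArc_false,
          inDegree_mdArc_true, h4]
  · have cay {S : Set G} (hS : S.ncard = 1) : IsUnionOfDirectedCycles (CayRel S) := by
      obtain ⟨s, rfl⟩ := Set.ncard_eq_one.1 hS
      intro g
      simp [outDegree, inDegree, CayRel, ← inv_mul_eq_iff_eq_mul, Set.ncard_eq_one]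
      exact ⟨s * g, by ext; simp [inv_mul_eq_iff_eq_mul]⟩
    have symm {S : Set G} (hS : S = S⁻¹) : ∀ u v, CayRel S u v → CayRel S v u := by
      rintro u _ ⟨s, hs, rfl⟩
      rw [hS] at hs
      exact ⟨s⁻¹, hs, by simp⟩
    have hBD : BDArc T0 T0 = MDArc ∅ ∅ T0 T0 := by
      funext u v
      simp [BDArc, MDArc]
    refine Or.inr (Or.inr ⟨?_, ?_⟩)
    · rcases h4 with h4 | h4
      · exact Or.inr ⟨cay h2, cay h1, symm h4⟩
      · exact Or.inl ⟨cay h1, cay h2, symm h4⟩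
    · rw [hBD]
      constructor
      · rintro ⟨g, _ | _⟩ <;>
          simp [outDegree_mdArc_false, outDegree_mdArc_true, inDegree_mdArc_false,
            inDegree_mdArc_true, h3]
      · rintro ⟨g, _ | _⟩ ⟨h, _ | _⟩ <;>
          simp [mdArc_false_false, mdArc_false_true, mdArc_true_false, mdArc_true_true]

end MixedCayley

section Fragment

variable {V : Type*} [Fintype V] [DecidableEq V] {R : V → V → Prop}

omit [Fintype V] [DecidableEq V] in
/-- A set closed under an arc relation is closed under reachability. -/
theorem mem_of_reflTransGen {A : Set V} (hA : ∀ u w, R u w → u ∈ A → w ∈ A) {u w : V}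
    (h : Relation.ReflTransGen R u w) (hu : u ∈ A) : w ∈ A := by
  induction h with
  | refl => exact hu
  | tail _ h ih => exact hA _ _ h ih

theorem cutSize_pos (hsc : DigraphStronglyConnected R) {C : Finset V} (hC : C.Nonempty)
    (hC' : C ≠ Finset.univ) : 0 < cutSize R C := by
  obtain ⟨u, hu⟩ := hC
  obtain ⟨w, hw⟩ : ∃ w, w ∉ C := by
    by_contra! hall
    exact hC' (Finset.eq_univ_iff_forall.2 hall)
  rw [cutSize_eq_ncard, Set.ncard_pos (Set.toFinite _)]
  by_contra hempty
  rw [Set.not_nonempty_iff_eq_empty] at hempty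
  refine hw (mem_of_reflTransGen (A := (C : Set V)) (fun a b hab ha => ?_) (hsc u w) hu)
  by_contra hb
  have : (a, b) ∈ omegaPlus R (C : Set V) := ⟨hab, ha, hb⟩
  simp [hempty] at this

theorem arcConnectivity_le_cutSize (R : V → V → Prop) {C : Finset V} (hC : C.Nonempty)
    (hC' : C ≠ Finset.univ) : arcConnectivity R ≤ cutSize R C := by
  refine Nat.sInf_le ⟨omegaPlus R C, ⟨fun p hp => hp.1, fun hsc => ?_⟩, (cutSize_eq_ncard R C).symm⟩
  have h := cutSize_pos hsc hC hC'
  rw [cutSize_eq_ncard, Set.ncard_pos (Set.toFinite _)] at h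
  obtain ⟨p, hp⟩ := h
  exact hp.1.2 ⟨hp.1.1, hp.2⟩

theorem exists_cutSize_eq_of_not_superLambda (hR : ∀ v, ¬ R v v) (hns : ¬ SuperLambda R) :
    ∃ C : Finset V, 2 ≤ C.card ∧ 2 ≤ Cᶜ.card ∧ cutSize R C = arcConnectivity R := by
  classical
  simp only [SuperLambda, not_forall, not_or, not_exists] at hns
  obtain ⟨W, ⟨-, hW⟩, hcard, hout, hin⟩ := hns
  simp only [DigraphStronglyConnected, not_forall] at hW
  obtain ⟨u, w, huw⟩ := hW
  set C : Finset V := Finset.univ.filter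
    fun x => Relation.ReflTransGen (fun u v => R u v ∧ (u, v) ∉ W) u x with hCdef
  have mem (x : V) : x ∈ C ↔ Relation.ReflTransGen (fun u v => R u v ∧ (u, v) ∉ W) u x := by
    simp [hCdef]
  have hu : u ∈ C := (mem u).2 .refl
  have hw : w ∉ C := fun h => huw ((mem w).1 h)
  have hsub : omegaPlus R (C : Set V) ⊆ W := by
    rintro ⟨a, b⟩ ⟨hab, ha, hb⟩
    by_contra hnot
    exact hb ((mem b).2 (((mem a).1 ha).tail ⟨hab, hnot⟩))
  have hle := arcConnectivity_le_cutSize R (C := C) ⟨u, hu⟩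
    (fun h => hw (h ▸ Finset.mem_univ w))
  have heq : omegaPlus R (C : Set V) = W :=
    Set.eq_of_subset_of_ncard_le hsub (by rw [hcard, ← cutSize_eq_ncard]; exact hle)
  refine ⟨C, ?_, ?_, by rw [cutSize_eq_ncard, heq, hcard]⟩
  · by_contra hlt
    have hone : C = {u} := (Finset.eq_of_subset_of_card_le (by simpa using hu)
      (by simp; omega)).symm
    refine hout u (heq.symm.trans ?_)
    ext ⟨a, b⟩
    simp only [omegaPlus, outArcsOf, hone, Finset.coe_singleton, Set.mem_singleton_iff,
      Set.mem_ofPred_eq]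
    refine ⟨fun h => ⟨h.1, h.2.1⟩, fun h => ⟨h.1, h.2, ?_⟩⟩
    rintro rfl
    exact hR b (h.2 ▸ h.1)
  · by_contra hlt
    have hone : Cᶜ = {w} := (Finset.eq_of_subset_of_card_le (by simpa using hw)
      (by simp only [Finset.card_singleton]; omega)).symm
    have hC (x : V) : x ∈ C ↔ x ≠ w := by
      rw [← not_iff_not, ← Finset.mem_compl, hone]
      simp
    refine hin w (heq.symm.trans ?_)
    ext ⟨a, b⟩
    simp only [omegaPlus, inArcsOf, Set.mem_ofPred_eq, Finset.mem_coe, hC, not_not]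
    refine ⟨fun h => ⟨h.1, h.2.2⟩, fun h => ⟨h.1, ?_, h.2⟩⟩
    rintro rfl
    exact hR a (h.2 ▸ h.1)

theorem isPosFragment_coe {C : Finset V} : IsPosFragment R (C : Set V) ↔
    C.Nonempty ∧ C ≠ Finset.univ ∧ cutSize R C = arcConnectivity R := by
  rw [IsPosFragment, cutSize_eq_ncard, Finset.coe_nonempty, Ne, Finset.coe_eq_univ]

theorem isNegFragment_coe {C : Finset V} : IsNegFragment R (C : Set V) ↔
    C.Nonempty ∧ C ≠ Finset.univ ∧ cutSize (fun u v => R v u) C = arcConnectivity R := by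
  have : omegaMinus R (C : Set V) = omegaPlus R ((Cᶜ : Finset V) : Set V) := by
    ext p
    simp [omegaMinus, omegaPlus]
  rw [IsNegFragment, cutSize_flip, cutSize_eq_ncard, this, Finset.coe_nonempty, Ne,
    Finset.coe_eq_univ]

theorem isCutBound_and_isCutBound_flip (hR : ∀ v, ¬ R v v) (hsc : DigraphStronglyConnected R)
    (hns : ¬ SuperLambda R) {k : ℕ} (hk : 2 ≤ k)
    (hmin : ∀ B, IsArcFragment R B → 2 ≤ B.ncard → k ≤ B.ncard) :
    IsCutBound R (arcConnectivity R) k ∧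
      IsCutBound (fun u v => R v u) (arcConnectivity R) k := by
  obtain ⟨C, hC, hC', hcut⟩ := exists_cutSize_eq_of_not_superLambda hR hns
  have hsum := Finset.card_add_card_compl C
  have hCne : C.Nonempty := Finset.card_pos.1 (by omega)
  have hCne' : Cᶜ.Nonempty := Finset.card_pos.1 (by omega)
  have hCu : C ≠ Finset.univ := by
    rintro rfl
    simp at hC'
  have hCu' : Cᶜ ≠ Finset.univ := by
    simpa [Finset.compl_eq_univ_iff] using hCne.ne_empty
  have hpos : 0 < arcConnectivity R := hcut ▸ cutSize_pos hsc hCne hCu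
  have h1 := hmin C (Or.inl (isPosFragment_coe.2 ⟨hCne, hCu, hcut⟩))
    (by rwa [Set.ncard_coe_finset])
  have h2 := hmin (Cᶜ : Finset V)
    (Or.inr (isNegFragment_coe.2 ⟨hCne', hCu', by rw [cutSize_flip, compl_compl, hcut]⟩))
    (by rwa [Set.ncard_coe_finset])
  rw [Set.ncard_coe_finset] at h1 h2
  refine ⟨⟨hR, hpos, hk, by omega, fun D => arcConnectivity_le_cutSize R,
      fun D hD hD' hDc hD2 => ?_⟩,
    ⟨hR, hpos, hk, by omega, fun D hD hD' => ?_, fun D hD hD' hDc hD2 => ?_⟩⟩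
  · simpa using hmin D (Or.inl (isPosFragment_coe.2 ⟨hD, hD', hDc⟩)) (by simpa using hD2)
  · rw [cutSize_flip]
    refine arcConnectivity_le_cutSize R ?_ ?_
    · rwa [Finset.nonempty_iff_ne_empty, Ne, Finset.compl_eq_empty_iff]
    · simpa [Finset.compl_eq_univ_iff] using hD.ne_empty
  · simpa using hmin D (Or.inr (isNegFragment_coe.2 ⟨hD, hD', hDc⟩)) (by simpa using hD2)

end Fragment

/-- distinct positive (resp. negative) λ-superatoms are vertex
disjoint. -/
theorem mixedCayley_superatoms_disjoint
    {G : Type*} [Group G] [Fintype G] (S0 S1 T0 T1 : Set G)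
    (hS0 : (1 : G) ∉ S0) (hS1 : (1 : G) ∉ S1)
    (hT0 : T0.Nonempty) (hT1 : T1.Nonempty)
    (hsc : DigraphStronglyConnected (MDArc S0 S1 T0 T1))
    (hmax : arcConnectivity (MDArc S0 S1 T0 T1) = minDegree (MDArc S0 S1 T0 T1))
    (hnsuper : ¬ SuperLambda (MDArc S0 S1 T0 T1))
    (hndir : ¬ IsDirectedCycleDigraph (MDArc S0 S1 T0 T1))
    (hnbidir : ¬ IsBidirectedCycleDigraph (MDArc S0 S1 T0 T1))
    (hnF : ¬ InClassF S0 S1 T0 T1) :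
    (∀ A B : Set (G × Bool), IsPosLambdaSuperatom (MDArc S0 S1 T0 T1) A →
      IsPosLambdaSuperatom (MDArc S0 S1 T0 T1) B → A ≠ B → A ∩ B = ∅) ∧
    (∀ A B : Set (G × Bool), IsNegLambdaSuperatom (MDArc S0 S1 T0 T1) A →
      IsNegLambdaSuperatom (MDArc S0 S1 T0 T1) B → A ≠ B → A ∩ B = ∅) := by
  classical
  have hR := mdArc_loopless (T0 := T0) (T1 := T1) hS0 hS1
  have hnE : ¬ IsExceptional S0 S1 T0 T1 := fun h => by
    rcases h.isDirectedCycle_or_isBidirectedCycle_or_inClassF hsc with h | h | h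
    · exact hndir h
    · exact hnbidir h
    · exact hnF h
  constructor
  all_goals
    intro A B hA hB hAB
    obtain ⟨A, rfl⟩ := (Set.toFinite A).exists_finset_coe
    obtain ⟨B, rfl⟩ := (Set.toFinite B).exists_finset_coe
    rw [Ne, Finset.coe_inj] at hAB
    obtain ⟨hA1, hA2, hA3⟩ := hA
    obtain ⟨hB1, hB2, hB3⟩ := hB
    obtain ⟨hpos, hneg⟩ := isCutBound_and_isCutBound_flip hR hsc hnsuper hA2 hA3
    rw [Set.ncard_coe_finset] at *
    by_contra hne
    obtain ⟨v, hvA, hvB⟩ := Set.nonempty_iff_ne_empty.2 hne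
  · have hcard : B.card = A.card := le_antisymm
      (by simpa using hB3 A (Or.inl hA1) (by simpa using hA2))
      (by simpa using hA3 B (Or.inl hB1) (by simpa using hB2))
    exact hnE (hpos.isExceptional_of_mem hT0 hT1 ⟨rfl, (isPosFragment_coe.1 hA1).2.2⟩
      ⟨hcard, (isPosFragment_coe.1 hB1).2.2⟩ hAB hvA hvB)
  · have hcard : B.card = A.card := le_antisymm
      (by simpa using hB3 A (Or.inr hA1) (by simpa using hA2))
      (by simpa using hA3 B (Or.inr hB1) (by simpa using hB2))
    have hcA := (isNegFragment_coe.1 hA1).2.2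
    have hcB := (isNegFragment_coe.1 hB1).2.2
    rw [mdArc_flip] at hneg hcA hcB
    exact hnE (hneg.isExceptional_of_mem hT1 hT0 ⟨rfl, hcA⟩ ⟨hcard, hcB⟩ hAB hvA hvB).of_flip
end
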